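/- Let d ≥ 1, T > 0, c > 0, U = (0,1)^d with boundary Γ and closure Ū; for 1 ≤ i ≤ d let Γ^{i,+} = {u ∈ Γ : u_i = 0} and Γ^{i,−} = {u ∈ Γ : u_i = 1}. Let g : Γ → ℝ be continuous and let ρ : [0,T] × Ū → ℝ be smooth, satisfy the heat equation ∂_t ρ(t,u) = Δρ(t,u) for all (t,u) ∈ (0,T] × U, and satisfy the Robin boundary conditions: for each i and all t ∈ [0,T], ∂_{u_i}ρ(t,u) = c (g(u) − ρ(t,u)) for u ∈ Γ^{i,−} and ∂_{u_i}ρ(t,u) = c (ρ(t,u) − g(u)) for u ∈ Γ^{i,+}. Then min_{(t,u) ∈ [0,T] × Ū} ρ(t,u) ≥ min{ min_{u ∈ Ū} ρ(0,u), min_{u ∈ Γ} g(u) }. -/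

import Mathlib

open scoped BigOperators
open Finset Filter

noncomputable section

/-- The open hypercube `U = (0,1)^d`. -/
def cubeO (d : ℕ) : Set (Fin d → ℝ) := {u | ∀ i, u i ∈ Set.Ioo (0 : ℝ) 1}

/-- The closed hypercube `Ū = [0,1]^d`. -/
def cubeC (d : ℕ) : Set (Fin d → ℝ) := {u | ∀ i, u i ∈ Set.Icc (0 : ℝ) 1}

/-- The boundary `Γ = Ū \ U`. -/
def cubeB (d : ℕ) : Set (Fin d → ℝ) := cubeC d \ cubeO d

/-- `Γ^{i,+} = {u ∈ Γ : u_i = 0}`. -/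
def GammaP (d : ℕ) (i : Fin d) : Set (Fin d → ℝ) := {u | u ∈ cubeB d ∧ u i = 0}

/-- `Γ^{i,-} = {u ∈ Γ : u_i = 1}`. -/
def GammaM (d : ℕ) (i : Fin d) : Set (Fin d → ℝ) := {u | u ∈ cubeB d ∧ u i = 1}

/-- Partial derivative in the `i`-th spatial coordinate (one-sided at the boundary
of `[0,1]`). -/
def pderiv (d : ℕ) (i : Fin d) (f : (Fin d → ℝ) → ℝ) (u : Fin d → ℝ) : ℝ :=
  derivWithin (fun s => f (Function.update u i s)) (Set.Icc 0 1) (u i)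

/-- First-order necessary condition for a minimum over a convex subset of the line. -/
lemma sub_mul_nonneg_of_isMinOn_of_hasDerivWithinAt {f : ℝ → ℝ} {S : Set ℝ} {x y D : ℝ}
    (hS : Convex ℝ S) (hx : x ∈ S) (hy : y ∈ S) (hmin : IsMinOn f S x)
    (hf : HasDerivWithinAt f D S x) : 0 ≤ (y - x) * D := by
  have := hmin.localize.hasFDerivWithinAt_nonneg hf.hasFDerivWithinAt
    (sub_mem_posTangentConeAt_of_segment_subset (hS.segment_subset hx hy))
  simpa using this

/-- Second-order necessary condition for a local minimum. -/
lemma deriv_deriv_nonneg_of_isLocalMin {f : ℝ → ℝ} {x : ℝ} (hmin : IsLocalMin f x)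
    (hf : ContinuousAt f x) : 0 ≤ deriv (deriv f) x := by
  by_contra! hneg
  have hmax := isLocalMax_of_deriv_deriv_neg hneg hmin.deriv_eq_zero hf
  have hconst : f =ᶠ[nhds x] fun _ => f x := by
    filter_upwards [hmin, hmax] with y h₁ h₂ using le_antisymm h₂ h₁
  have : deriv (deriv f) x = 0 := by
    rw [hconst.deriv.deriv_eq]
    simp
  exact hneg.ne this

lemma derivWithin_derivWithin_nonneg_of_isMinOn {f : ℝ → ℝ} {S : Set ℝ} {x : ℝ}
    (hS : S ∈ nhds x) (hmin : IsMinOn f S x) (hf : ContinuousOn f S) :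
    0 ≤ derivWithin (derivWithin f S) S x := by
  have h : derivWithin f S =ᶠ[nhds x] deriv f := by
    filter_upwards [eventually_mem_nhds_iff.2 hS] with y hy using derivWithin_of_mem_nhds hy
  rw [derivWithin_of_mem_nhds hS, h.deriv_eq]
  exact deriv_deriv_nonneg_of_isLocalMin (hmin.isLocalMin hS) (hf.continuousAt hS)

lemma pderiv_pderiv_eq (d : ℕ) (i : Fin d) (f : (Fin d → ℝ) → ℝ) (u : Fin d → ℝ) :
    pderiv d i (pderiv d i f) u =
      derivWithin (derivWithin (fun s => f (Function.update u i s)) (Set.Icc 0 1))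
        (Set.Icc 0 1) (u i) := by
  unfold pderiv
  simp only [Function.update_idem, Function.update_self]

lemma cubeC_eq_pi (d : ℕ) : cubeC d = Set.univ.pi fun _ => Set.Icc (0 : ℝ) 1 := by
  ext u
  simp only [cubeC, Set.mem_ofPred_eq, Set.mem_univ_pi]

lemma isCompact_cubeC (d : ℕ) : IsCompact (cubeC d) := by
  rw [cubeC_eq_pi]
  exact isCompact_univ_pi fun _ => isCompact_Icc

lemma isOpen_cubeO (d : ℕ) : IsOpen (cubeO d) := by
  have : cubeO d = Set.univ.pi fun _ => Set.Ioo (0 : ℝ) 1 := by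
    ext u
    simp [cubeO]
  rw [this]
  exact isOpen_set_pi Set.finite_univ fun _ _ => isOpen_Ioo

lemma isCompact_cubeB (d : ℕ) : IsCompact (cubeB d) :=
  (isCompact_cubeC d).diff (isOpen_cubeO d)

lemma update_mem_cubeC {d : ℕ} {u : Fin d → ℝ} (hu : u ∈ cubeC d) (i : Fin d) {s : ℝ}
    (hs : s ∈ Set.Icc (0 : ℝ) 1) : Function.update u i s ∈ cubeC d := by
  intro j
  rcases eq_or_ne j i with rfl | h
  · simpa using hs
  · simpa [h] using hu j

lemma sInf_le_apply_of_continuousOn {X : Type*} [TopologicalSpace X] {K : Set X} {f : X → ℝ}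
    (hK : IsCompact K) (hf : ContinuousOn f K) {x : X} (hx : x ∈ K) :
    sInf {r : ℝ | ∃ u ∈ K, r = f u} ≤ f x := by
  refine csInf_le ?_ ⟨x, hx, rfl⟩
  obtain ⟨b, hb⟩ := hK.bddBelow_image hf
  exact ⟨b, by rintro _ ⟨u, hu, rfl⟩; exact hb ⟨u, hu, rfl⟩⟩

/-- A face point of the cube cannot be a spatial minimum with value below the boundary datum
when the Robin conditions hold. -/
lemma boundary_datum_le_of_isMinOn {d : ℕ} {c : ℝ} (hc : 0 < c) {g f : (Fin d → ℝ) → ℝ}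
    {u : Fin d → ℝ} (hu : u ∈ cubeB d) (hmin : IsMinOn f (cubeC d) u)
    (hbc : ∀ i : Fin d, (u ∈ GammaM d i → pderiv d i f u = c * (g u - f u)) ∧
      (u ∈ GammaP d i → pderiv d i f u = c * (f u - g u))) : g u ≤ f u := by
  by_contra! hlt
  have hpos : 0 < c * (g u - f u) := mul_pos hc (sub_pos.2 hlt)
  obtain ⟨i, hi⟩ : ∃ i, u i ∉ Set.Ioo (0 : ℝ) 1 := by
    simpa only [cubeO, Set.mem_ofPred_eq, not_forall] using hu.2
  have hline : IsMinOn (fun s => f (Function.update u i s)) (Set.Icc 0 1) (u i) := by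
    intro s hs
    simpa using hmin (update_mem_cubeC hu.1 i hs)
  have key : ∀ y ∈ Set.Icc (0 : ℝ) 1, pderiv d i f u ≠ 0 → 0 ≤ (y - u i) * pderiv d i f u :=
    fun y hy hne => sub_mul_nonneg_of_isMinOn_of_hasDerivWithinAt (convex_Icc 0 1) (hu.1 i) hy hline
      (differentiableWithinAt_of_derivWithin_ne_zero hne).hasDerivWithinAt
  have hi01 : u i = 0 ∨ u i = 1 := by
    have h := hu.1 i
    by_contra! hne
    exact hi ⟨lt_of_le_of_ne h.1 hne.1.symm, lt_of_le_of_ne h.2 hne.2⟩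
  rcases hi01 with h | h
  · have hD := (hbc i).2 ⟨hu, h⟩
    have := key 1 (by simp) (by rw [hD]; linarith)
    rw [hD, h] at this
    linarith
  · have hD := (hbc i).1 ⟨hu, h⟩
    have := key 0 (by simp) (by rw [hD]; linarith)
    rw [hD, h] at this
    linarith

lemma sum_pderiv_pderiv_nonneg_of_isMinOn {d : ℕ} {f : (Fin d → ℝ) → ℝ} {u : Fin d → ℝ}
    (hu : u ∈ cubeO d) (hmin : IsMinOn f (cubeC d) u) (hf : ContinuousOn f (cubeC d)) :
    0 ≤ ∑ i, pderiv d i (pderiv d i f) u := by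
  have huC : u ∈ cubeC d := fun i => Set.Ioo_subset_Icc_self (hu i)
  refine Finset.sum_nonneg fun i _ => ?_
  rw [pderiv_pderiv_eq]
  refine derivWithin_derivWithin_nonneg_of_isMinOn (Icc_mem_nhds (hu i).1 (hu i).2) ?_ ?_
  · intro s hs
    simpa using hmin (update_mem_cubeC huC i hs)
  · have hupd : Continuous (Function.update u i) :=
      (continuous_const (y := u)).update i continuous_id
    exact hf.comp hupd.continuousOn fun s hs => update_mem_cubeC huC i hs

/-- **Minimum principle, Robin case** (analogue of Theorem 5.1 of the paper for θ = 1):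
a smooth solution of the heat equation on `(0,T] × U` with Robin boundary conditions is
bounded below by the minimum of its initial values and of the boundary data `g`. -/
theorem minimum_principle_robin
    (d : ℕ) (hd : 1 ≤ d) (T c : ℝ) (hT : 0 < T) (hc : 0 < c)
    (g : (Fin d → ℝ) → ℝ) (hg : ContinuousOn g (cubeB d))
    (ρ : ℝ → (Fin d → ℝ) → ℝ)
    (hρ_smooth : ContDiffOn ℝ (⊤ : ℕ∞) (fun p : ℝ × (Fin d → ℝ) => ρ p.1 p.2)
      (Set.Icc 0 T ×ˢ cubeC d))
    (hheat : ∀ t ∈ Set.Ioc (0 : ℝ) T, ∀ u ∈ cubeO d,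
      HasDerivWithinAt (fun s => ρ s u)
        (∑ i, pderiv d i (pderiv d i (ρ t)) u) (Set.Ioc 0 T) t)
    (hbc : ∀ t ∈ Set.Icc (0 : ℝ) T, ∀ i : Fin d,
      (∀ u ∈ GammaM d i, pderiv d i (ρ t) u = c * (g u - ρ t u)) ∧
      (∀ u ∈ GammaP d i, pderiv d i (ρ t) u = c * (ρ t u - g u))) :
    sInf {r : ℝ | ∃ t ∈ Set.Icc (0 : ℝ) T, ∃ u ∈ cubeC d, r = ρ t u}
      ≥ min (sInf {r : ℝ | ∃ u ∈ cubeC d, r = ρ 0 u})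
          (sInf {r : ℝ | ∃ u ∈ cubeB d, r = g u}) := by
  set m := min (sInf {r : ℝ | ∃ u ∈ cubeC d, r = ρ 0 u})
    (sInf {r : ℝ | ∃ u ∈ cubeB d, r = g u})
  have hcont := hρ_smooth.continuousOn
  have hslice : ∀ t ∈ Set.Icc (0 : ℝ) T, ContinuousOn (ρ t) (cubeC d) := fun t ht =>
    hcont.comp (f := fun u => (t, u)) (by fun_prop) fun u hu => ⟨ht, hu⟩
  have h0 : ∀ u ∈ cubeC d, m ≤ ρ 0 u := fun u hu =>
    (min_le_left _ _).trans
      (sInf_le_apply_of_continuousOn (isCompact_cubeC d) (hslice 0 ⟨le_rfl, hT.le⟩) hu)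
  have hgm : ∀ u ∈ cubeB d, m ≤ g u := fun u hu =>
    (min_le_right _ _).trans (sInf_le_apply_of_continuousOn (isCompact_cubeB d) hg hu)
  have hne : (cubeC d).Nonempty := ⟨fun _ => 0, fun _ => by simp⟩
  have perturbed : ∀ ε > 0, ∀ t ∈ Set.Icc (0 : ℝ) T, ∀ u ∈ cubeC d, m ≤ ρ t u + ε * t := by
    intro ε hε
    obtain ⟨⟨t, u⟩, ⟨ht, hu⟩, hmin⟩ := (isCompact_Icc.prod (isCompact_cubeC d)).exists_isMinOn
      ((Set.nonempty_Icc.2 hT.le).prod hne)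
      (hcont.add (g := fun p => ε * p.1) (by fun_prop))
    have hmin' : ∀ s ∈ Set.Icc (0 : ℝ) T, ∀ v ∈ cubeC d, ρ t u + ε * t ≤ ρ s v + ε * s :=
      fun s hs v hv => hmin (show (s, v) ∈ _ from ⟨hs, hv⟩)
    suffices m ≤ ρ t u + ε * t from fun s hs v hv => this.trans (hmin' s hs v hv)
    rcases ht.1.eq_or_lt with rfl | htpos
    · simpa using h0 u hu
    have hspace : IsMinOn (ρ t) (cubeC d) u := fun v hv => by
      simpa using hmin' t ht v hv
    by_cases huO : u ∈ cubeO d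
    · exfalso
      have hΔ := sum_pderiv_pderiv_nonneg_of_isMinOn huO hspace (hslice t ht)
      have hder := (hheat t ⟨htpos, ht.2⟩ u huO).add
        ((hasDerivWithinAt_id t (Set.Ioc 0 T)).const_mul ε)
      have htime : IsMinOn (fun s => ρ s u + ε * s) (Set.Ioc 0 T) t :=
        fun s hs => hmin' s (Set.Ioc_subset_Icc_self hs) u hu
      have := sub_mul_nonneg_of_isMinOn_of_hasDerivWithinAt (convex_Ioc 0 T) ⟨htpos, ht.2⟩
        (show t / 2 ∈ Set.Ioc 0 T from ⟨by linarith, by linarith [ht.2]⟩)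
        htime hder
      nlinarith
    · have huB : u ∈ cubeB d := ⟨hu, huO⟩
      have := boundary_datum_le_of_isMinOn hc huB hspace
        fun i => ⟨(hbc t ht i).1 u, (hbc t ht i).2 u⟩
      linarith [hgm u huB, mul_pos hε htpos]
  refine le_csInf ?_ ?_
  · obtain ⟨u, hu⟩ := hne
    exact ⟨ρ 0 u, 0, ⟨le_rfl, hT.le⟩, u, hu, rfl⟩
  · rintro _ ⟨t, ht, u, hu, rfl⟩
    refine le_of_forall_pos_le_add fun δ hδ => ?_
    have := perturbed (δ / T) (by positivity) t ht u hu
    have hle : δ / T * t ≤ δ := by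
      rw [div_mul_eq_mul_div, div_le_iff₀ hT]
      exact mul_le_mul_of_nonneg_left ht.2 hδ.le
    linarith

end
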